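/- The 2p−1 product states ψ_1,…,ψ_{2p−1} form an orthonormal family in ℂ^m ⊗ ℂ^n: each ψ_k has norm 1, and ⟨ψ_k, ψ_l⟩ = 0 whenever k ≠ l. -/

import Mathlib

open scoped ComplexInnerProductSpace Kronecker ComplexOrder

/-- The `i`-th standard basis vector `|i⟩` of `ℂ^m` (zero if `i ≥ m`). -/
noncomputable def ket (m i : ℕ) : EuclideanSpace ℂ (Fin m) :=
  (WithLp.equiv 2 (Fin m → ℂ)).symm fun a => if (a : ℕ) = i then 1 else 0

/-- The product state `v ⊗ w`, with entries `(v ⊗ w)_{(a,b)} = v_a * w_b`. -/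
noncomputable def tp {m n : ℕ} (v : EuclideanSpace ℂ (Fin m)) (w : EuclideanSpace ℂ (Fin n)) :
    EuclideanSpace ℂ (Fin m × Fin n) :=
  (WithLp.equiv 2 (Fin m × Fin n → ℂ)).symm fun ab => v ab.1 * w ab.2

/-- The scalar `1/√2`. -/
noncomputable def invSqrt2 : ℂ := ((Real.sqrt 2)⁻¹ : ℝ)

/-- A matrix on `ℂ^m ⊗ ℂ^n` acting as a linear map. -/
noncomputable def act {m n : ℕ} (M : Matrix (Fin m × Fin n) (Fin m × Fin n) ℂ)
    (x : EuclideanSpace ℂ (Fin m × Fin n)) : EuclideanSpace ℂ (Fin m × Fin n) :=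
  Matrix.toEuclideanLin M x

/-- The index `j(i)`: `j(i) = i + 1` for `i ≤ p - 2`, and `j(p-1) = 1`. -/
def jf (p i : ℕ) : ℕ := if i = p - 1 then 1 else i + 1

/-- The unnormalized uniform superposition `|0⟩ + |1⟩ + ⋯ + |p-1⟩` in `ℂ^m`. -/
noncomputable def unif (m p : ℕ) : EuclideanSpace ℂ (Fin m) :=
  ∑ i ∈ Finset.range p, ket m i

/-- The `2p-1` product states `ψ_k` (`1 ≤ k ≤ 2p-1`) of Theorem 2:
`ψ_i = |i⟩ ⊗ (|0⟩-|i⟩)/√2`, `ψ_{i+p-1} = (|0⟩-|i⟩)/√2 ⊗ |j(i)⟩` for `1 ≤ i ≤ p-1`,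
and `ψ_{2p-1} = (1/p)(|0⟩+⋯+|p-1⟩) ⊗ (|0⟩+⋯+|p-1⟩)`. -/
noncomputable def psi2 (m n p k : ℕ) : EuclideanSpace ℂ (Fin m × Fin n) :=
  if k ≤ p - 1 then tp (ket m k) (invSqrt2 • (ket n 0 - ket n k))
  else if k ≤ 2 * p - 2 then
    tp (invSqrt2 • (ket m 0 - ket m (k - (p - 1)))) (ket n (jf p (k - (p - 1))))
  else ((p : ℂ))⁻¹ • tp (unif m p) (unif n p)


lemma inner_tp {m n : ℕ} (v v' : EuclideanSpace ℂ (Fin m)) (w w' : EuclideanSpace ℂ (Fin n)) :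
    ⟪tp v w, tp v' w'⟫ = ⟪v, v'⟫ * ⟪w, w'⟫ := by
  simp only [PiLp.inner_apply, tp, Fintype.sum_prod_type, Finset.sum_mul_sum]
  refine Finset.sum_congr rfl fun a _ => Finset.sum_congr rfl fun b _ => ?_
  simp
  ring

lemma inner_ket_ket {m i : ℕ} (hi : i < m) (j : ℕ) :
    ⟪ket m i, ket m j⟫ = if i = j then 1 else 0 := by
  rw [PiLp.inner_apply, Finset.sum_eq_single ⟨i, hi⟩]
  · simp [ket]
  · intro a _ ha
    have : (a : ℕ) ≠ i := fun h => ha (Fin.ext h)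
    simp [ket, this]
  · simp

lemma inner_ket_unif {m i p : ℕ} (hi : i < p) (hpm : p ≤ m) : ⟪ket m i, unif m p⟫ = 1 := by
  simp [unif, inner_ket_ket (hi.trans_le hpm), hi]

lemma inner_unif_ket {m i p : ℕ} (hi : i < p) (hpm : p ≤ m) : ⟪unif m p, ket m i⟫ = 1 := by
  rw [← inner_conj_symm, inner_ket_unif hi hpm, map_one]

lemma inner_unif_unif {m p : ℕ} (hpm : p ≤ m) : ⟪unif m p, unif m p⟫ = p := by
  conv_lhs => enter [2]; rw [unif]
  rw [sum_inner, Finset.sum_congr rfl fun i hi => inner_ket_unif (Finset.mem_range.1 hi) hpm]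
  simp

lemma conj_invSqrt2 : (starRingEnd ℂ) invSqrt2 = invSqrt2 := Complex.conj_ofReal _

lemma invSqrt2_mul_self : invSqrt2 * invSqrt2 = 1 / 2 := by
  rw [invSqrt2, ← Complex.ofReal_mul, ← mul_inv, Real.mul_self_sqrt zero_le_two]
  simp

lemma jf_lt {p i : ℕ} (hp : 3 ≤ p) (hi : i < p) : jf p i < p := by
  unfold jf; split_ifs <;> omega

lemma jf_pos (p i : ℕ) : 0 < jf p i := by
  unfold jf; split_ifs <;> omega

lemma jf_ne_self {p i : ℕ} (hp : 3 ≤ p) : jf p i ≠ i := by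
  unfold jf; split_ifs <;> omega

lemma jf_inj {p i j : ℕ} (hi : 1 ≤ i) (hj : 1 ≤ j) : jf p i = jf p j ↔ i = j := by
  unfold jf; split_ifs <;> omega

/-- The Gram matrix of the states `psi2 m n p k` is the identity. -/
lemma inner_psi2 {p m n k l : ℕ} (h3 : 3 ≤ p) (hpm : p ≤ m) (hmn : m ≤ n)
    (hk : 1 ≤ k) (hk' : k ≤ 2 * p - 1) (hl : 1 ≤ l) (hl' : l ≤ 2 * p - 1) :
    ⟪psi2 m n p k, psi2 m n p l⟫ = if k = l then 1 else 0 := by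
  have hpn := hpm.trans hmn
  have hp : (p : ℂ) ≠ 0 := by exact_mod_cast (by omega : p ≠ 0)
  have ketm : ∀ {i}, i < p → ∀ j, ⟪ket m i, ket m j⟫ = if i = j then 1 else 0 :=
    fun hi => inner_ket_ket (hi.trans_le hpm)
  have ketn : ∀ {i}, i < p → ∀ j, ⟪ket n i, ket n j⟫ = if i = j then 1 else 0 :=
    fun hi => inner_ket_ket (hi.trans_le hpn)
  have h0 : 0 < p := by omega
  have hs := invSqrt2_mul_self
  have block : ∀ {k}, 1 ≤ k → k ≤ 2 * p - 1 →
      (k < p ∧ psi2 m n p k = tp (ket m k) (invSqrt2 • (ket n 0 - ket n k))) ∨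
      (∃ i, 1 ≤ i ∧ i < p ∧ k = i + (p - 1) ∧
        psi2 m n p k = tp (invSqrt2 • (ket m 0 - ket m i)) (ket n (jf p i))) ∨
      (k = 2 * p - 1 ∧ psi2 m n p k = (p : ℂ)⁻¹ • tp (unif m p) (unif n p)) := by
    intro k hk hk'
    unfold psi2
    split_ifs with h₁ h₂
    · exact .inl ⟨by omega, rfl⟩
    · exact .inr (.inl ⟨k - (p - 1), by omega, by omega, by omega, rfl⟩)
    · exact .inr (.inr ⟨by omega, rfl⟩)
  rcases block hk hk' with ⟨hkp, ek⟩ | ⟨i, hi, hip, rfl, ek⟩ | ⟨rfl, ek⟩ <;>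
  rcases block hl hl' with ⟨hlp, el⟩ | ⟨j, hj, hjp, rfl, el⟩ | ⟨rfl, el⟩ <;>
  simp only [ek, el, inner_tp, inner_smul_left, inner_smul_right, inner_sub_left, inner_sub_right,
    conj_invSqrt2]
  · simp only [ketm hkp, ketn h0, ketn hkp, show k ≠ 0 by omega, show 0 ≠ l by omega]
    by_cases h : k = l
    · simp only [h, if_true, if_false]
      linear_combination 2 * hs
    · simp [h]
  · simp only [ketm hkp, ketn h0, ketn hkp, show k ≠ 0 by omega, (jf_pos p j).ne,
      show k ≠ j + (p - 1) by omega]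
    by_cases h : k = j
    · simp [h, (jf_ne_self h3).symm]
    · simp [h]
  · simp [inner_ket_unif h0 hpn, inner_ket_unif hkp hpn, show k ≠ 2 * p - 1 by omega]
  · simp only [ketm h0, ketm hip, ketn (jf_lt h3 hip), show 0 ≠ l by omega, (jf_pos p i).ne',
      show i + (p - 1) ≠ l by omega]
    by_cases h : i = l
    · simp [← h, jf_ne_self h3]
    · simp [h]
  · simp only [ketm h0, ketm hip, ketn (jf_lt h3 hip), show i ≠ 0 by omega, show 0 ≠ j by omega,
      jf_inj hi hj, Nat.add_right_cancel_iff]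
    by_cases h : i = j
    · simp only [h, if_true, if_false]
      linear_combination 2 * hs
    · simp [h]
  · simp [inner_ket_unif h0 hpm, inner_ket_unif hip hpm, show i + (p - 1) ≠ 2 * p - 1 by omega]
  · simp [inner_unif_ket h0 hpn, inner_unif_ket hlp hpn, show 2 * p - 1 ≠ l by omega]
  · simp [inner_unif_ket h0 hpm, inner_unif_ket hjp hpm, show 2 * p - 1 ≠ j + (p - 1) by omega]
  · rw [inner_unif_unif hpm, inner_unif_unif hpn, if_pos trivial, map_inv₀, Complex.conj_natCast]
    field_simp

theorem two_p_minus_one_orthonormal (p m n : ℕ) (h3 : 3 ≤ p) (hpm : p ≤ m) (hmn : m ≤ n) :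
    (∀ k, 1 ≤ k → k ≤ 2 * p - 1 → ‖psi2 m n p k‖ = 1) ∧
    (∀ k l, 1 ≤ k → k ≤ 2 * p - 1 → 1 ≤ l → l ≤ 2 * p - 1 → k ≠ l →
      ⟪psi2 m n p k, psi2 m n p l⟫ = 0) := by
  refine ⟨fun k hk hk' => ?_, fun k l hk hk' hl hl' hkl => ?_⟩
  · rw [@norm_eq_sqrt_re_inner ℂ, inner_psi2 h3 hpm hmn hk hk' hk hk']
    simp
  · rw [inner_psi2 h3 hpm hmn hk hk' hl hl', if_neg hkl]
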